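/- With S as the limiting SINR random variable S = L₀h̃/(Σ_{x_i∈Ψ}L(|x_i|)h_i + 2πγ/(αζ)), where Ψ is a PPP of intensity β/(2πζ), the expected value admits the integral representation 𝔼[S] = ∫₀^∞ L₀ · exp( −2πγt/(αζ) − (β/ζ)·∫₀^∞ 𝔼_h[1 − e^{−t h L(r)}] r dr ) dt. -/

import Mathlib

open MeasureTheory ProbabilityTheory Real Set Filter ENNReal

noncomputable section

/-- The Euclidean plane `ℝ²`. -/
abbrev Plane := EuclideanSpace ℝ (Fin 2)

/-- A Poisson point process (Poisson random measure) on a measurable space `E`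
with intensity measure `Λ`, defined on a probability space `(Ω, P)`:
counts of disjoint sets are independent, and the count of any set `A` of finite
intensity is Poisson distributed with mean `Λ A`. -/
structure PoissonPP {Ω E : Type*} [MeasurableSpace Ω] [MeasurableSpace E]
    (P : Measure Ω) (Λ : Measure E) where
  N : Ω → Measure E
  measurable_count : ∀ A : Set E, MeasurableSet A → Measurable fun ω => N ω A
  poisson_count : ∀ A : Set E, MeasurableSet A → Λ A ≠ ⊤ → ∀ k : ℕ,
    P {ω | N ω A = k} =
      ENNReal.ofReal (Real.exp (-(Λ A).toReal) * (Λ A).toReal ^ k / (Nat.factorial k))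
  indep_count : ∀ A B : Set E, MeasurableSet A → MeasurableSet B → Disjoint A B →
    IndepFun (fun ω => N ω A) (fun ω => N ω B) P

/-- The marked shot noise `I(ω) = Σ_{(x_i,h_i) ∈ N(ω)} L(‖x_i‖)·h_i` of a marked
point process on `ℝ² × ℝ` (points with real marks). -/
def shotNoise {Ω : Type*} [MeasurableSpace Ω] {P : Measure Ω} {Λ : Measure (Plane × ℝ)}
    (pp : PoissonPP P Λ) (L : ℝ → ℝ) (ω : Ω) : ℝ≥0∞ :=
  ∫⁻ p, ENNReal.ofReal (L ‖p.1‖ * p.2) ∂(pp.N ω)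

lemma PoissonPP.meas_eq {Ω E : Type*} [MeasurableSpace Ω] [MeasurableSpace E]
    {P : Measure Ω} {Λ : Measure E} (pp : PoissonPP P Λ) {A : Set E} (hA : MeasurableSet A)
    (x : ℝ≥0∞) : MeasurableSet {ω | pp.N ω A = x} :=
  (pp.measurable_count A hA) (measurableSet_singleton x)

lemma PoissonPP.ae_nat {Ω E : Type*} [MeasurableSpace Ω] [MeasurableSpace E]
    {P : Measure Ω} [IsProbabilityMeasure P] {Λ : Measure E} (pp : PoissonPP P Λ)
    {A : Set E} (hA : MeasurableSet A) (hf : Λ A ≠ ⊤) :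
    ∀ᵐ ω ∂P, ω ∈ ⋃ k : ℕ, {ω | pp.N ω A = k} := by
  have hm : MeasurableSet (⋃ k : ℕ, {ω | pp.N ω A = k}) :=
    MeasurableSet.iUnion fun k => pp.meas_eq hA _
  have h1 : P (⋃ k : ℕ, {ω | pp.N ω A = k}) = 1 := by
    rw [measure_iUnion _ (fun k => pp.meas_eq hA _)]
    · simp_rw [pp.poisson_count A hA hf]
      have : HasSum (fun n : ℕ => Real.exp (-(Λ A).toReal) * (Λ A).toReal ^ n / (Nat.factorial n)) 1 :=
        hasSum_one_poissonMeasure (Λ A).toNNReal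
      rw [← ENNReal.ofReal_tsum_of_nonneg _ this.summable]
      · rw [this.tsum_eq]; simp
      · intro n; positivity
    · intro i j hij
      rw [Function.onFun, Set.disjoint_left]
      intro ω h1 h2
      simp only [mem_ofPred_eq] at h1 h2
      rw [h1] at h2
      exact hij (by exact_mod_cast h2)
  rw [ae_iff]
  exact (prob_compl_eq_zero_iff hm).2 h1

lemma PoissonPP.lintegral_count {Ω E : Type*} [MeasurableSpace Ω] [MeasurableSpace E]
    {P : Measure Ω} [IsProbabilityMeasure P] {Λ : Measure E} (pp : PoissonPP P Λ)
    {A : Set E} (hA : MeasurableSet A) (hf : Λ A ≠ ⊤) :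
    ∫⁻ ω, pp.N ω A ∂P = Λ A := by
  have h0 := pp.ae_nat hA hf
  rw [← setLIntegral_univ, ← setLIntegral_congr (s := ⋃ k : ℕ, {ω | pp.N ω A = k}) (by
    rw [Filter.eventuallyEq_univ]; exact h0)]
  rw [lintegral_iUnion (fun k => pp.meas_eq hA _)]
  · have h2 : ∀ k : ℕ, ∫⁻ ω in {ω | pp.N ω A = k}, pp.N ω A ∂P =
        ENNReal.ofReal (k * (Real.exp (-(Λ A).toReal) * (Λ A).toReal ^ k / (Nat.factorial k))) := by
      intro k
      rw [setLIntegral_congr_fun (g := fun _ => (k : ℝ≥0∞)) (pp.meas_eq hA _) (fun ω h => h),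
        setLIntegral_const, pp.poisson_count A hA hf, ENNReal.ofReal_mul (by positivity)]
      simp
    simp_rw [h2]
    have hs : HasSum (fun k : ℕ => (k : ℝ) * (Real.exp (-(Λ A).toReal) * (Λ A).toReal ^ k / (Nat.factorial k)))
        (Λ A).toReal := by
      rw [← hasSum_nat_add_iff' 1]
      have := (hasSum_one_poissonMeasure (Λ A).toNNReal).mul_left (Λ A).toReal
      simp only [Finset.range_one, Finset.sum_singleton, CharP.cast_eq_zero, zero_mul, sub_zero]
      rw [mul_one] at this
      refine this.congr_fun ?_ |> fun h => h
      intro k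
      rw [Nat.factorial_succ]
      change _ = (Λ A).toReal * (Real.exp (-(Λ A).toReal) * (Λ A).toReal ^ k / _)
      push_cast
      field_simp
      ring
    rw [← ENNReal.ofReal_tsum_of_nonneg _ hs.summable, hs.tsum_eq, ENNReal.ofReal_toReal hf]
    intro n; positivity
  · intro i j hij
    rw [Function.onFun, Set.disjoint_left]
    intro ω h1 h2
    simp only [mem_ofPred_eq] at h1 h2
    rw [h1] at h2
    exact hij (by exact_mod_cast h2)

lemma PoissonPP.measurable_N {Ω E : Type*} [MeasurableSpace Ω] [MeasurableSpace E]
    {P : Measure Ω} {Λ : Measure E} (pp : PoissonPP P Λ) : Measurable pp.N :=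
  Measure.measurable_of_measurable_coe _ pp.measurable_count

lemma PoissonPP.bind_eq {Ω E : Type*} [MeasurableSpace Ω] [MeasurableSpace E]
    {P : Measure Ω} [IsProbabilityMeasure P] {Λ : Measure E} [SigmaFinite Λ]
    (pp : PoissonPP P Λ) : P.bind pp.N = Λ := by
  rw [Measure.ext_iff_of_iUnion_eq_univ (iUnion_spanningSets Λ)]
  intro i
  ext s hs
  have hm := hs.inter (measurableSet_spanningSets Λ i)
  rw [Measure.restrict_apply hs, Measure.restrict_apply hs,
    Measure.bind_apply hm pp.measurable_N.aemeasurable]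
  exact pp.lintegral_count hm
    ((measure_mono Set.inter_subset_right).trans_lt (measure_spanningSets_lt_top Λ i)).ne

lemma PoissonPP.campbell {Ω E : Type*} [MeasurableSpace Ω] [MeasurableSpace E]
    {P : Measure Ω} [IsProbabilityMeasure P] {Λ : Measure E} [SigmaFinite Λ]
    (pp : PoissonPP P Λ) {f : E → ℝ≥0∞} (hf : Measurable f) :
    ∫⁻ ω, ∫⁻ p, f p ∂(pp.N ω) ∂P = ∫⁻ p, f p ∂Λ := by
  rw [← Measure.lintegral_bind pp.measurable_N.aemeasurable hf.aemeasurable, pp.bind_eq]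

/-- Void probabilities: expectation of products of shifted emptiness indicators. -/
lemma PoissonPP.void_prod {Ω E ι : Type*} [MeasurableSpace Ω] [MeasurableSpace E]
    {P : Measure Ω} [IsProbabilityMeasure P] {Λ : Measure E} (pp : PoissonPP P Λ)
    (s : Finset ι) (C : ι → Set E) (hC : ∀ i ∈ s, MeasurableSet (C i))
    (hd : (s : Set ι).PairwiseDisjoint C) (hf : ∀ i ∈ s, Λ (C i) ≠ ⊤) (c d : ι → ℝ) :
    ∫ ω, ∏ i ∈ s, (c i * ({ω | pp.N ω (C i) = 0}.indicator 1 ω) + d i) ∂P =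
      ∏ i ∈ s, (c i * Real.exp (-(Λ (C i)).toReal) + d i) := by
  classical
  simp_rw [Finset.prod_add, Finset.prod_mul_distrib]
  have hmU : ∀ T ∈ s.powerset, MeasurableSet (⋃ i ∈ T, C i) := fun T hT =>
    Finset.measurableSet_biUnion _ fun i hi => hC i (Finset.mem_powerset.1 hT hi)
  have key : ∀ T ∈ s.powerset, ∀ ω, ∏ i ∈ T, ({ω | pp.N ω (C i) = 0}.indicator (1 : Ω → ℝ) ω)
      = {ω | pp.N ω (⋃ i ∈ T, C i) = 0}.indicator (1 : Ω → ℝ) ω := by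
    intro T hT ω
    by_cases h : ∀ i ∈ T, pp.N ω (C i) = 0
    · rw [Finset.prod_eq_one, Set.indicator_of_mem]
      · rfl
      · simp only [mem_ofPred_eq]
        exact (measure_biUnion_null_iff T.countable_toSet).2 h
      · intro i hi
        rw [Set.indicator_of_mem]
        · rfl
        · exact h i hi
    · rw [Set.indicator_of_notMem]
      · push Not at h
        obtain ⟨i, hi, h⟩ := h
        apply Finset.prod_eq_zero hi
        rw [Set.indicator_of_notMem]
        exact h
      · intro h'
        exact h ((measure_biUnion_null_iff T.countable_toSet).1 h')
  rw [integral_finsetSum]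
  · apply Finset.sum_congr rfl
    intro T hT
    have hsub := Finset.mem_powerset.1 hT
    simp_rw [key T hT]
    rw [integral_mul_const, integral_const_mul, integral_indicator_one (pp.meas_eq (hmU T hT) 0)]
    congr 2
    have hU : Λ (⋃ i ∈ T, C i) = ∑ i ∈ T, Λ (C i) :=
      measure_biUnion_finset (hd.subset (by exact_mod_cast hsub)) (fun i hi => hC i (hsub hi))
    have hUf : Λ (⋃ i ∈ T, C i) ≠ ⊤ := by
      rw [hU]; exact (ENNReal.sum_lt_top.2 fun i hi => (hf i (hsub hi)).lt_top).ne
    have := pp.poisson_count _ (hmU T hT) hUf 0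
    simp only [CharP.cast_eq_zero, pow_zero, mul_one, Nat.factorial_zero, Nat.cast_one, div_one] at this
    rw [Measure.real, this, ENNReal.toReal_ofReal (Real.exp_pos _).le, hU,
      ENNReal.toReal_sum fun i hi => hf i (hsub hi), ← Finset.sum_neg_distrib, Real.exp_sum]
  · intro T hT
    simp_rw [key T hT]
    apply Integrable.mul_const
    apply Integrable.const_mul
    exact (integrable_const 1).indicator (pp.meas_eq (hmU T hT) 0)

lemma abs_prod_sub_prod_le_sum {ι : Type*} (s : Finset ι) (x y : ι → ℝ)
    (hx : ∀ i ∈ s, 0 ≤ x i ∧ x i ≤ 1) (hy : ∀ i ∈ s, 0 ≤ y i ∧ y i ≤ 1) :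
    |∏ i ∈ s, x i - ∏ i ∈ s, y i| ≤ ∑ i ∈ s, |x i - y i| := by
  classical
  induction s using Finset.induction_on with
  | empty => simp
  | insert a s ha ih =>
    rw [Finset.prod_insert ha, Finset.prod_insert ha, Finset.sum_insert ha]
    have h1 := ih (fun i hi => hx i (Finset.mem_insert_of_mem hi))
      (fun i hi => hy i (Finset.mem_insert_of_mem hi))
    have hxa := hx a (Finset.mem_insert_self _ _)
    have hP0 : 0 ≤ ∏ i ∈ s, y i := Finset.prod_nonneg fun i hi =>
      (hy i (Finset.mem_insert_of_mem hi)).1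
    have hP1 : ∏ i ∈ s, y i ≤ 1 := Finset.prod_le_one (fun i hi =>
      (hy i (Finset.mem_insert_of_mem hi)).1) (fun i hi => (hy i (Finset.mem_insert_of_mem hi)).2)
    have e : x a * ∏ i ∈ s, x i - y a * ∏ i ∈ s, y i =
      x a * (∏ i ∈ s, x i - ∏ i ∈ s, y i) + (x a - y a) * ∏ i ∈ s, y i := by ring
    rw [e]
    refine (abs_add_le _ _).trans ?_
    rw [abs_mul, abs_mul, abs_of_nonneg hxa.1, abs_of_nonneg hP0]
    have := mul_le_of_le_one_left (abs_nonneg (∏ i ∈ s, x i - ∏ i ∈ s, y i)) hxa.2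
    have := mul_le_of_le_one_right (abs_nonneg (x a - y a)) hP1
    linarith

lemma one_sub_exp_lower {x : ℝ} (hx : 0 ≤ x) : x - x ^ 2 / 2 ≤ 1 - Real.exp (-x) := by
  have h := Real.quadratic_le_exp_of_nonneg hx
  have h2 : Real.exp (-x) * Real.exp x = 1 := by rw [← Real.exp_add]; simp
  have h3 := Real.exp_pos (-x)
  have h4 : Real.exp (-x) * (1 + x + x ^ 2 / 2) ≤ 1 := by nlinarith
  have h5 : 0 < 1 + x + x ^ 2 / 2 := by positivity
  have h6 : 1 ≤ (1 - x + x ^ 2 / 2) * (1 + x + x ^ 2 / 2) := by nlinarith [sq_nonneg (x ^ 2)]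
  have h7 : Real.exp (-x) ≤ 1 - x + x ^ 2 / 2 := by
    by_contra! h
    nlinarith
  linarith

lemma one_sub_exp_upper (x : ℝ) : 1 - Real.exp (-x) ≤ x := by
  have := Real.add_one_le_exp (-x)
  linarith

lemma factor_est {c l : ℝ} (hc0 : 0 ≤ c) (hc1 : c ≤ 1) (hl : 0 ≤ l) :
    |(c * Real.exp (-l) + (1 - c)) - Real.exp (-(c * l))| ≤ l ^ 2 := by
  have h1 := one_sub_exp_lower hl
  have h2 := one_sub_exp_upper l
  have h3 := one_sub_exp_lower (mul_nonneg hc0 hl)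
  have h4 := one_sub_exp_upper (c * l)
  have h5 : c ^ 2 ≤ 1 := by nlinarith
  have h6 : (c * l) ^ 2 ≤ l ^ 2 := by rw [mul_pow]; nlinarith [sq_nonneg l]
  rw [abs_le]
  constructor
  · nlinarith [mul_le_mul_of_nonneg_left h2 hc0]
  · nlinarith [mul_le_mul_of_nonneg_left h1 hc0, mul_le_mul_of_nonneg_right hc1 (sq_nonneg l)]

lemma PoissonPP.integrable_count {Ω E : Type*} [MeasurableSpace Ω] [MeasurableSpace E]
    {P : Measure Ω} [IsProbabilityMeasure P] {Λ : Measure E} (pp : PoissonPP P Λ)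
    {A : Set E} (hA : MeasurableSet A) (hf : Λ A ≠ ⊤) :
    Integrable (fun ω => (pp.N ω A).toReal) P :=
  integrable_toReal_of_lintegral_ne_top (pp.measurable_count A hA).aemeasurable
    (by rw [pp.lintegral_count hA hf]; exact hf)

lemma PoissonPP.integral_count {Ω E : Type*} [MeasurableSpace Ω] [MeasurableSpace E]
    {P : Measure Ω} [IsProbabilityMeasure P] {Λ : Measure E} (pp : PoissonPP P Λ)
    {A : Set E} (hA : MeasurableSet A) (hf : Λ A ≠ ⊤) :
    ∫ ω, (pp.N ω A).toReal ∂P = (Λ A).toReal := by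
  rw [integral_toReal (pp.measurable_count A hA).aemeasurable, pp.lintegral_count hA hf]
  filter_upwards [pp.ae_nat hA hf] with ω h
  obtain ⟨k, hk⟩ := Set.mem_iUnion.1 h
  simp only [mem_ofPred_eq] at hk
  rw [hk]; exact ENNReal.natCast_lt_top k

/-- Quantitative Laplace functional estimate for a fine partition. -/
lemma PoissonPP.laplace_est {Ω E ι : Type*} [MeasurableSpace Ω] [MeasurableSpace E]
    {P : Measure Ω} [IsProbabilityMeasure P] {Λ : Measure E} (pp : PoissonPP P Λ)
    (s : Finset ι) (C : ι → Set E) (hC : ∀ i ∈ s, MeasurableSet (C i))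
    (hd : (s : Set ι).PairwiseDisjoint C) (hf : ∀ i ∈ s, Λ (C i) ≠ ⊤)
    (a : ι → ℝ) (ha : ∀ i, 0 ≤ a i) :
    |∫ ω, Real.exp (-∑ i ∈ s, a i * (pp.N ω (C i)).toReal) ∂P -
      Real.exp (-∑ i ∈ s, (1 - Real.exp (-a i)) * (Λ (C i)).toReal)| ≤
      ∑ i ∈ s, (a i + 1) * (Λ (C i)).toReal ^ 2 := by
  set z : ι → Ω → ℝ := fun i => {ω | pp.N ω (C i) = 0}.indicator 1 with hz
  set n : ι → Ω → ℝ := fun i ω => (pp.N ω (C i)).toReal with hn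
  set l : ι → ℝ := fun i => (Λ (C i)).toReal with hl
  have hl0 : ∀ i, 0 ≤ l i := fun i => ENNReal.toReal_nonneg
  set c : ι → ℝ := fun i => 1 - Real.exp (-a i) with hc
  have hc0 : ∀ i, 0 ≤ c i := fun i => by
    have : Real.exp (-a i) ≤ 1 := Real.exp_le_one_iff.2 (by linarith [ha i])
    simp only [hc]; linarith
  have hc1 : ∀ i, c i ≤ 1 := fun i => by
    have := Real.exp_pos (-a i)
    simp only [hc]; linarith
  have hz01 : ∀ i ω, z i ω = 0 ∨ z i ω = 1 := fun i ω => by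
    simp only [hz, Set.indicator_apply]; split_ifs <;> simp
  have hvoid := pp.void_prod s C hC hd hf c (fun i => 1 - c i)
  have hzint : ∀ i ∈ s, Integrable (z i) P := fun i hi =>
    (integrable_const (1:ℝ)).indicator (pp.meas_eq (hC i hi) 0)
  have hnint : ∀ i ∈ s, Integrable (n i) P := fun i hi => pp.integrable_count (hC i hi) (hf i hi)
  have hzE : ∀ i ∈ s, ∫ ω, z i ω ∂P = Real.exp (-l i) := by
    intro i hi
    simp only [hz]
    rw [integral_indicator_one (pp.meas_eq (hC i hi) 0)]
    have := pp.poisson_count _ (hC i hi) (hf i hi) 0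
    simp only [CharP.cast_eq_zero, pow_zero, mul_one, Nat.factorial_zero, Nat.cast_one, div_one] at this
    rw [Measure.real, this, ENNReal.toReal_ofReal (Real.exp_pos _).le]
  -- pointwise bound
  have hpt : ∀ᵐ ω ∂P, |Real.exp (-∑ i ∈ s, a i * n i ω) - ∏ i ∈ s, (c i * z i ω + (1 - c i))| ≤
      ∑ i ∈ s, a i * (n i ω - (1 - z i ω)) := by
    have h1 : ∀ᵐ ω ∂P, ∀ i ∈ s, ω ∈ ⋃ k : ℕ, {ω | pp.N ω (C i) = k} :=
      (ae_ball_iff s.countable_toSet).2 fun i hi => pp.ae_nat (hC i hi) (hf i hi)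
    filter_upwards [h1] with ω h1
    rw [← Finset.sum_neg_distrib, Real.exp_sum]
    refine (abs_prod_sub_prod_le_sum s _ _ ?_ ?_).trans (Finset.sum_le_sum ?_)
    · intro i hi
      refine ⟨(Real.exp_pos _).le, Real.exp_le_one_iff.2 ?_⟩
      have := mul_nonneg (ha i) (ENNReal.toReal_nonneg : 0 ≤ n i ω)
      linarith
    · intro i hi
      have := hc0 i
      have := hc1 i
      rcases hz01 i ω with h | h <;> rw [h] <;> constructor <;> linarith
    · intro i hi
      obtain ⟨k, hk⟩ := Set.mem_iUnion.1 (h1 i hi)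
      simp only [mem_ofPred_eq] at hk
      rcases Nat.eq_zero_or_pos k with rfl | hk0
      · have e1 : n i ω = 0 := by simp [hn, hk]
        have e2 : z i ω = 1 := by simp [hz, hk]
        rw [e1, e2]; simp
      · have e1 : n i ω = k := by simp [hn, hk]
        have e2 : z i ω = 0 := by
          simp only [hz]
          rw [Set.indicator_of_notMem]
          simp only [mem_ofPred_eq, hk]
          exact_mod_cast hk0.ne'
        rw [e1, e2]
        have hk1 : (1:ℝ) ≤ k := by exact_mod_cast hk0
        have e3 : Real.exp (-(a i * k)) = Real.exp (-a i) * Real.exp (-(a i * (k - 1))) := by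
          rw [← Real.exp_add]; congr 1; ring
        have h5 : 0 ≤ a i * (k - 1) := mul_nonneg (ha i) (by linarith)
        have h6 := one_sub_exp_upper (a i * (k - 1))
        have h7 : Real.exp (-(a i * (k - 1))) ≤ 1 := Real.exp_le_one_iff.2 (by linarith)
        have h8 : Real.exp (-a i) ≤ 1 := Real.exp_le_one_iff.2 (by linarith [ha i])
        have h9 := Real.exp_pos (-a i)
        rw [e3, abs_le]
        simp only [hc]
        constructor <;> nlinarith
  have hintP : Integrable (fun ω => ∏ i ∈ s, (c i * z i ω + (1 - c i))) P := by
    refine Integrable.of_bound (C := 1) ?_ ?_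
    · apply AEMeasurable.aestronglyMeasurable
      refine Finset.aemeasurable_fun_prod s fun i hi => ?_
      exact ((hzint i hi).aemeasurable.const_mul _).add_const _
    · refine Filter.Eventually.of_forall fun ω => ?_
      have h01 : ∀ i ∈ s, 0 ≤ c i * z i ω + (1 - c i) ∧ c i * z i ω + (1 - c i) ≤ 1 := by
        intro i hi
        have := hc0 i
        have := hc1 i
        rcases hz01 i ω with h | h <;> rw [h] <;> constructor <;> linarith
      rw [Real.norm_of_nonneg (Finset.prod_nonneg fun i hi => (h01 i hi).1)]
      exact Finset.prod_le_one (fun i hi => (h01 i hi).1) (fun i hi => (h01 i hi).2)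
  have hintE : Integrable (fun ω => Real.exp (-∑ i ∈ s, a i * n i ω)) P := by
    refine Integrable.of_bound (C := 1) ?_ ?_
    · apply AEMeasurable.aestronglyMeasurable
      refine Real.measurable_exp.comp_aemeasurable (AEMeasurable.neg ?_)
      refine Finset.aemeasurable_fun_sum s fun i hi => ?_
      exact ((hnint i hi).aemeasurable.const_mul _)
    · refine Filter.Eventually.of_forall fun ω => ?_
      rw [Real.norm_of_nonneg (Real.exp_pos _).le, Real.exp_le_one_iff]
      have : 0 ≤ ∑ i ∈ s, a i * n i ω :=
        Finset.sum_nonneg fun i hi => mul_nonneg (ha i) ENNReal.toReal_nonneg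
      linarith
  have hA : |∫ ω, Real.exp (-∑ i ∈ s, a i * n i ω) ∂P -
      ∏ i ∈ s, (c i * Real.exp (-l i) + (1 - c i))| ≤ ∑ i ∈ s, a i * l i ^ 2 := by
    rw [← hvoid, ← integral_sub hintE hintP]
    refine (abs_integral_le_integral_abs).trans ?_
    have hi2 : ∀ i ∈ s, Integrable (fun ω => a i * (n i ω - (1 - z i ω))) P := fun i hi =>
      ((hnint i hi).sub ((integrable_const _).sub (hzint i hi))).const_mul _
    refine (integral_mono_ae (hintE.sub hintP).abs (integrable_finsetSum s hi2) hpt).trans ?_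
    rw [integral_finsetSum s hi2]
    refine Finset.sum_le_sum fun i hi => ?_
    have h1z : Integrable (fun ω => 1 - z i ω) P := (integrable_const _).sub (hzint i hi)
    rw [integral_const_mul, integral_sub (hnint i hi) h1z,
      integral_sub (integrable_const _) (hzint i hi), hzE i hi, pp.integral_count (hC i hi) (hf i hi)]
    apply mul_le_mul_of_nonneg_left _ (ha i)
    have := one_sub_exp_lower (hl0 i)
    simp only [integral_const, probReal_univ, smul_eq_mul, mul_one]
    change l i - _ ≤ _
    nlinarith [sq_nonneg (l i)]
  have hB : |∏ i ∈ s, (c i * Real.exp (-l i) + (1 - c i)) - Real.exp (-∑ i ∈ s, c i * l i)| ≤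
      ∑ i ∈ s, l i ^ 2 := by
    rw [← Finset.sum_neg_distrib, Real.exp_sum]
    refine (abs_prod_sub_prod_le_sum s _ _ ?_ ?_).trans (Finset.sum_le_sum ?_)
    · intro i hi
      have h1 := hc0 i
      have h2 := hc1 i
      have h3 := Real.exp_pos (-l i)
      have h4 : Real.exp (-l i) ≤ 1 := Real.exp_le_one_iff.2 (by linarith [hl0 i])
      constructor <;> nlinarith
    · intro i hi
      refine ⟨(Real.exp_pos _).le, Real.exp_le_one_iff.2 ?_⟩
      have := mul_nonneg (hc0 i) (hl0 i)
      linarith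
    · intro i hi
      exact factor_est (hc0 i) (hc1 i) (hl0 i)
  refine (abs_sub_le _ _ _).trans ((add_le_add hA hB).trans ?_)
  rw [← Finset.sum_add_distrib]
  refine Finset.sum_le_sum fun i hi => ?_
  apply le_of_eq
  change _ = (a i + 1) * l i ^ 2
  ring

/-- Every set of finite measure can be cut into finitely many pieces of small measure. -/
def FinePart {E : Type*} [MeasurableSpace E] (Λ : Measure E) : Prop :=
  ∀ B : Set E, MeasurableSet B → Λ B ≠ ⊤ → ∀ ε : ℝ, 0 < ε → ∃ (m : ℕ) (g : E → ℕ),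
    Measurable g ∧ (∀ x, g x < m) ∧ ∀ j, (Λ (B ∩ g ⁻¹' {j})).toReal ≤ ε

lemma finePart_of_countable {E : Type*} [MeasurableSpace E] (Λ : Measure E)
    (h : ∀ ε : ℝ, 0 < ε → ∃ g : E → ℕ, Measurable g ∧ ∀ j, Λ (g ⁻¹' {j}) ≤ ENNReal.ofReal ε) :
    FinePart Λ := by
  intro B hB hBf ε hε
  obtain ⟨g, hg, hgε⟩ := h ε hε
  have hm : ∀ n, MeasurableSet (B ∩ g ⁻¹' (Set.Ici n)) := fun n => hB.inter (hg measurableSet_Ici)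
  have ht := tendsto_measure_iInter_atTop (μ := Λ) (s := fun n => B ∩ g ⁻¹' (Set.Ici n))
    (fun n => (hm n).nullMeasurableSet)
    (fun i j hij x hx => ⟨hx.1, le_trans hij hx.2⟩)
    ⟨0, ((measure_mono Set.inter_subset_left).trans_lt hBf.lt_top).ne⟩
  have he : (⋂ n, B ∩ g ⁻¹' (Set.Ici n)) = ∅ := by
    ext x
    simp only [Set.mem_iInter, Set.mem_empty_iff_false, iff_false, not_forall]
    refine ⟨g x + 1, fun hx => ?_⟩
    have : g x + 1 ≤ g x := hx.2
    omega
  rw [he, measure_empty] at ht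
  obtain ⟨n, hn⟩ := (ht.eventually_lt_const (ENNReal.ofReal_pos.2 hε)).exists
  refine ⟨n + 1, fun x => min (g x) n, hg.min measurable_const, fun x => by
    show min (g x) n < n + 1
    omega, fun j => ?_⟩
  apply ENNReal.toReal_le_of_le_ofReal hε.le
  rcases lt_or_ge j n with hj | hj
  · refine (measure_mono ?_).trans (hgε j)
    rintro x ⟨-, hx⟩
    simp only [Set.mem_preimage, Set.mem_singleton_iff] at hx ⊢
    omega
  · refine (measure_mono ?_).trans hn.le
    rintro x ⟨hxB, hx⟩
    refine ⟨hxB, ?_⟩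
    simp only [Set.mem_preimage, Set.mem_singleton_iff, Set.mem_Ici] at hx ⊢
    omega

lemma finePart_plane (c : ℝ) (hc : 0 < c) (ν : Measure ℝ) [IsProbabilityMeasure ν] :
    FinePart ((ENNReal.ofReal c • (volume : Measure Plane)).prod ν) := by
  classical
  apply finePart_of_countable
  intro ε hε
  set r : ℝ := √(ε / (c * π)) with hr
  have hrpos : 0 < r := Real.sqrt_pos.2 (by positivity)
  have hex : ∀ p : Plane × ℝ, ∃ k : ℕ, p.1 ∈ Metric.ball (TopologicalSpace.denseSeq Plane k) r := by
    intro p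
    obtain ⟨k, hk⟩ := (TopologicalSpace.denseRange_denseSeq Plane).exists_dist_lt p.1 hrpos
    exact ⟨k, hk⟩
  refine ⟨fun p => Nat.find (hex p), measurable_find hex fun k => ?_, fun j => ?_⟩
  · exact measurable_fst measurableSet_ball
  · have hsub : (fun p => Nat.find (hex p)) ⁻¹' {j} ⊆
        (Metric.ball (TopologicalSpace.denseSeq Plane j) r) ×ˢ Set.univ := by
      intro p hp
      have h1 : Nat.find (hex p) = j := hp
      exact ⟨h1 ▸ Nat.find_spec (hex p), trivial⟩
    refine (measure_mono hsub).trans ?_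
    rw [Measure.prod_prod, measure_univ, mul_one, Measure.smul_apply,
      EuclideanSpace.volume_ball_fin_two, smul_eq_mul, ← ENNReal.ofReal_pow hrpos.le,
      ← ENNReal.ofReal_mul (by positivity), ← ENNReal.ofReal_mul (by positivity)]
    apply ENNReal.ofReal_le_ofReal
    rw [hr, Real.sq_sqrt (by positivity)]
    apply le_of_eq
    field_simp

/-- Joint Laplace transform of counts of disjoint sets. -/
lemma PoissonPP.laplace_finset {Ω E ι : Type*} [MeasurableSpace Ω] [MeasurableSpace E]
    {P : Measure Ω} [IsProbabilityMeasure P] {Λ : Measure E} (pp : PoissonPP P Λ)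
    (hΛ : FinePart Λ)
    (s : Finset ι) (A : ι → Set E) (hA : ∀ i ∈ s, MeasurableSet (A i))
    (hd : (s : Set ι).PairwiseDisjoint A) (hf : ∀ i ∈ s, Λ (A i) ≠ ⊤)
    (a : ι → ℝ) (ha : ∀ i, 0 ≤ a i) :
    ∫ ω, Real.exp (-∑ i ∈ s, a i * (pp.N ω (A i)).toReal) ∂P =
      Real.exp (-∑ i ∈ s, (1 - Real.exp (-a i)) * (Λ (A i)).toReal) := by
  set K : ℝ := ∑ i ∈ s, (a i + 1) * (Λ (A i)).toReal with hK
  have hK0 : 0 ≤ K := Finset.sum_nonneg fun i hi =>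
    mul_nonneg (by linarith [ha i]) ENNReal.toReal_nonneg
  have main : ∀ ε : ℝ, 0 < ε → |∫ ω, Real.exp (-∑ i ∈ s, a i * (pp.N ω (A i)).toReal) ∂P -
      Real.exp (-∑ i ∈ s, (1 - Real.exp (-a i)) * (Λ (A i)).toReal)| ≤ K * ε := by
    intro ε hε
    have hBm : MeasurableSet (⋃ i ∈ s, A i) := Finset.measurableSet_biUnion _ hA
    have hBf : Λ (⋃ i ∈ s, A i) ≠ ⊤ :=
      ((measure_biUnion_finset_le s A).trans_lt
        (ENNReal.sum_lt_top.2 fun i hi => (hf i hi).lt_top)).ne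
    obtain ⟨m, g, hg, hgm, hgε⟩ := hΛ _ hBm hBf ε hε
    let C : ι × ℕ → Set E := fun q => A q.1 ∩ g ⁻¹' {q.2}
    have hCm : ∀ q ∈ s ×ˢ Finset.range m, MeasurableSet (C q) := fun q hq =>
      (hA _ (Finset.mem_product.1 hq).1).inter (hg (measurableSet_singleton _))
    have hCf : ∀ q ∈ s ×ˢ Finset.range m, Λ (C q) ≠ ⊤ := fun q hq =>
      ((measure_mono Set.inter_subset_left).trans_lt (hf _ (Finset.mem_product.1 hq).1).lt_top).ne
    have hCd : ((s ×ˢ Finset.range m : Finset (ι × ℕ)) : Set (ι × ℕ)).PairwiseDisjoint C := by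
      rintro ⟨i, j⟩ hq ⟨i', j'⟩ hq' hne
      rw [Function.onFun, Set.disjoint_left]
      rintro x ⟨hx1, hx2⟩ ⟨hx3, hx4⟩
      simp only [Set.mem_preimage, Set.mem_singleton_iff] at hx1 hx2 hx3 hx4
      have hii : i = i' := by
        by_contra hii
        exact Set.disjoint_left.1 (hd (Finset.mem_product.1 hq).1 (Finset.mem_product.1 hq').1 hii)
          hx1 hx3
      exact hne (by rw [hii, ← hx2, ← hx4])
    have hest := pp.laplace_est (s ×ˢ Finset.range m) C hCm hCd hCf (fun q => a q.1)
      (fun q => ha q.1)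
    have hsplit : ∀ (μ : Measure E), ∀ i ∈ s, μ (A i) = ∑ j ∈ Finset.range m, μ (C (i, j)) := by
      intro μ i hi
      rw [← measure_biUnion_finset]
      · congr 1
        ext x
        simp only [C, Set.mem_iUnion, Set.mem_inter_iff, Set.mem_preimage, Set.mem_singleton_iff,
          Finset.mem_range, exists_prop]
        constructor
        · intro hx; exact ⟨g x, hgm x, hx, rfl⟩
        · rintro ⟨j, -, hx, -⟩; exact hx
      · intro j hj j' hj' hne
        exact hCd (by simp at hj ⊢; exact ⟨hi, hj⟩) (by simp at hj' ⊢; exact ⟨hi, hj'⟩) (by simpa using hne)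
      · intro j hj
        exact hCm (i, j) (Finset.mem_product.2 ⟨hi, hj⟩)
    have hΛs : ∀ b : ι → ℝ, ∑ q ∈ s ×ˢ Finset.range m, b q.1 * (Λ (C q)).toReal =
        ∑ i ∈ s, b i * (Λ (A i)).toReal := by
      intro b
      rw [Finset.sum_product]
      refine Finset.sum_congr rfl fun i hi => ?_
      rw [hsplit Λ i hi, ENNReal.toReal_sum, Finset.mul_sum]
      intro j hj
      exact hCf (i, j) (Finset.mem_product.2 ⟨hi, hj⟩)
    have hNs : ∀ᵐ ω ∂P, Real.exp (-∑ q ∈ s ×ˢ Finset.range m, a q.1 * (pp.N ω (C q)).toReal) =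
        Real.exp (-∑ i ∈ s, a i * (pp.N ω (A i)).toReal) := by
      have h1 : ∀ᵐ ω ∂P, ∀ q ∈ s ×ˢ Finset.range m, ω ∈ ⋃ k : ℕ, {ω | pp.N ω (C q) = k} :=
        (ae_ball_iff (s ×ˢ Finset.range m).countable_toSet).2
          fun i hi => pp.ae_nat (hCm i hi) (hCf i hi)
      filter_upwards [h1] with ω h1
      rw [Finset.sum_product]
      congr 2
      refine Finset.sum_congr rfl fun i hi => ?_
      rw [hsplit (pp.N ω) i hi, ENNReal.toReal_sum, Finset.mul_sum]
      intro j hj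
      obtain ⟨k, hk⟩ := Set.mem_iUnion.1 (h1 (i, j) (Finset.mem_product.2 ⟨hi, hj⟩))
      simp only [mem_ofPred_eq] at hk
      rw [hk]; exact ENNReal.natCast_ne_top k
    rw [integral_congr_ae hNs, hΛs (fun i => 1 - Real.exp (-a i))] at hest
    refine hest.trans ?_
    rw [hK, ← hΛs (fun i => a i + 1), Finset.sum_mul]
    refine Finset.sum_le_sum fun q hq => ?_
    rw [pow_two, ← mul_assoc]
    apply mul_le_mul_of_nonneg_left _ (mul_nonneg (by linarith [ha q.1]) ENNReal.toReal_nonneg)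
    refine le_trans (ENNReal.toReal_mono ?_ (measure_mono ?_)) (hgε q.2)
    · exact ((measure_mono Set.inter_subset_left).trans_lt hBf.lt_top).ne
    · intro x hx
      exact ⟨Set.mem_biUnion (Finset.mem_product.1 hq).1 hx.1, hx.2⟩
  rw [← sub_eq_zero, ← abs_nonpos_iff]
  apply _root_.le_of_forall_pos_le_add
  intro δ hδ
  refine (main (δ / (K + 1)) (by positivity)).trans ?_
  rw [zero_add, mul_div_assoc', div_le_iff₀ (by positivity)]
  nlinarith

lemma PoissonPP.laplace_simple {Ω E : Type*} [MeasurableSpace Ω] [MeasurableSpace E]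
    {P : Measure Ω} [IsProbabilityMeasure P] {Λ : Measure E} (pp : PoissonPP P Λ)
    (hΛ : FinePart Λ) (f : SimpleFunc E ℝ≥0∞) (hft : ∀ x, f x ≠ ⊤)
    (hf : ∫⁻ x, f x ∂Λ ≠ ⊤) :
    ∫ ω, Real.exp (-(∫⁻ x, f x ∂(pp.N ω)).toReal) ∂P =
      Real.exp (-∫ x, (1 - Real.exp (-(f x).toReal)) ∂Λ) := by
  classical
  rw [SimpleFunc.lintegral_eq_lintegral] at hf
  have hfs := SimpleFunc.finMeasSupp_iff.1 (SimpleFunc.FinMeasSupp.of_lintegral_ne_top hf)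
  set s := f.range.filter (· ≠ 0) with hs
  have hfin : ∀ y ∈ s, Λ (f ⁻¹' {y}) ≠ ⊤ := fun y hy => (hfs y (Finset.mem_filter.1 hy).2).ne
  have hmeas : ∀ y ∈ s, MeasurableSet (f ⁻¹' {y}) := fun y _ => f.measurableSet_fiber y
  have hd : (s : Set ℝ≥0∞).PairwiseDisjoint (fun y => f ⁻¹' {y}) := by
    intro y _ y' _ hne
    rw [Function.onFun, Set.disjoint_left]
    intro x hx hx'
    exact hne (hx.symm.trans hx')
  have hL := pp.laplace_finset hΛ s (fun y => f ⁻¹' {y}) hmeas hd hfin (fun y => y.toReal)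
    (fun y => ENNReal.toReal_nonneg)
  have hst : ∀ y ∈ s, y ≠ ⊤ := by
    intro y hy
    obtain ⟨x, rfl⟩ := SimpleFunc.mem_range.1 (Finset.mem_filter.1 hy).1
    exact hft x
  have hN : ∀ᵐ ω ∂P, Real.exp (-∑ y ∈ s, y.toReal * (pp.N ω (f ⁻¹' {y})).toReal) =
      Real.exp (-(∫⁻ x, f x ∂(pp.N ω)).toReal) := by
    have h1 : ∀ᵐ ω ∂P, ∀ y ∈ s, ω ∈ ⋃ k : ℕ, {ω | pp.N ω (f ⁻¹' {y}) = k} :=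
      (ae_ball_iff s.countable_toSet).2 fun i hi => pp.ae_nat (hmeas i hi) (hfin i hi)
    filter_upwards [h1] with ω h1
    rw [SimpleFunc.lintegral_eq_lintegral, SimpleFunc.lintegral,
      ← Finset.sum_filter_of_ne (s := f.range) (p := (· ≠ 0)), ENNReal.toReal_sum]
    · simp_rw [ENNReal.toReal_mul]; rfl
    · intro y hy
      obtain ⟨k, hk⟩ := Set.mem_iUnion.1 (h1 y hy)
      simp only [mem_ofPred_eq] at hk
      rw [hk]
      exact ENNReal.mul_ne_top (hst y hy) (ENNReal.natCast_ne_top k)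
    · intro y _ h0 h; exact h0 (by rw [h, zero_mul])
  rw [← integral_congr_ae hN, hL]
  congr 2
  have hfm : ∀ x, 1 - Real.exp (-(f x).toReal) =
      ∑ y ∈ s, (f ⁻¹' {y}).indicator (fun _ => 1 - Real.exp (-y.toReal)) x := by
    intro x
    by_cases h0 : f x = 0
    · rw [Finset.sum_eq_zero, h0]
      · simp
      · intro y hy
        rw [Set.indicator_of_notMem]
        intro hx
        exact (Finset.mem_filter.1 hy).2 (hx.symm.trans h0)
    · rw [Finset.sum_eq_single (f x)]
      · rw [Set.indicator_of_mem (show x ∈ f ⁻¹' {f x} from rfl)]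
      · intro y _ hne
        rw [Set.indicator_of_notMem]
        intro hx; exact hne hx.symm
      · intro h
        exact absurd (Finset.mem_filter.2 ⟨SimpleFunc.mem_range_self f x, h0⟩) h
  simp_rw [hfm]
  rw [integral_finsetSum]
  · refine Finset.sum_congr rfl fun y hy => ?_
    rw [integral_indicator_const _ (hmeas y hy), smul_eq_mul, mul_comm]; rfl
  · intro y hy
    exact (integrable_indicator_iff (hmeas y hy)).2 (integrableOn_const (hfin y hy))

/-- Laplace functional of a Poisson point process. -/
lemma PoissonPP.laplace {Ω E : Type*} [MeasurableSpace Ω] [MeasurableSpace E]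
    {P : Measure Ω} [IsProbabilityMeasure P] {Λ : Measure E} [SigmaFinite Λ]
    (pp : PoissonPP P Λ)
    (hΛ : FinePart Λ) (f : E → ℝ≥0∞) (hfm : Measurable f)
    (hf : ∫⁻ x, f x ∂Λ ≠ ⊤) :
    ∫ ω, Real.exp (-(∫⁻ x, f x ∂(pp.N ω)).toReal) ∂P =
      Real.exp (-∫ x, (1 - Real.exp (-(f x).toReal)) ∂Λ) := by
  let F : ℕ → SimpleFunc E ℝ≥0∞ := SimpleFunc.eapprox f
  have hFle : ∀ n x, F n x ≤ f x := fun n x => by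
    rw [← SimpleFunc.iSup_eapprox_apply hfm x]
    exact le_iSup (fun n => (SimpleFunc.eapprox f n) x) n
  have hfae : ∀ᵐ x ∂Λ, f x < ⊤ := ae_lt_top hfm hf
  have hI : ∀ᵐ ω ∂P, ∫⁻ x, f x ∂(pp.N ω) < ⊤ := by
    apply ae_lt_top
    · exact (Measure.measurable_lintegral hfm).comp pp.measurable_N
    · rw [pp.campbell hfm]; exact hf
  have hsim : ∀ n, ∫ ω, Real.exp (-(∫⁻ x, F n x ∂(pp.N ω)).toReal) ∂P =
      Real.exp (-∫ x, (1 - Real.exp (-(F n x).toReal)) ∂Λ) := fun n =>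
    pp.laplace_simple hΛ (F n) (fun x => (SimpleFunc.eapprox_lt_top f n x).ne)
      ((lintegral_mono (hFle n)).trans_lt hf.lt_top).ne
  have ht1 : Tendsto (fun n => ∫ ω, Real.exp (-(∫⁻ x, F n x ∂(pp.N ω)).toReal) ∂P) atTop
      (nhds (∫ ω, Real.exp (-(∫⁻ x, f x ∂(pp.N ω)).toReal) ∂P)) := by
    apply tendsto_integral_of_dominated_convergence (fun _ => (1:ℝ))
    · intro n
      exact (((Measure.measurable_lintegral (F n).measurable).comp
        pp.measurable_N).ennreal_toReal.neg.exp).aestronglyMeasurable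
    · exact integrable_const _
    · intro n
      refine Filter.Eventually.of_forall fun ω => ?_
      rw [Real.norm_of_nonneg (Real.exp_pos _).le, Real.exp_le_one_iff]
      simp
    · filter_upwards [hI] with ω hω
      have : Tendsto (fun n => ∫⁻ x, F n x ∂(pp.N ω)) atTop (nhds (∫⁻ x, f x ∂(pp.N ω))) :=
        lintegral_tendsto_of_tendsto_of_monotone (fun n => (F n).measurable.aemeasurable)
          (Filter.Eventually.of_forall fun x i j hij => SimpleFunc.monotone_eapprox f hij x)
          (Filter.Eventually.of_forall fun x => SimpleFunc.tendsto_eapprox hfm x)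
      exact (Real.continuous_exp.tendsto _).comp
        (((ENNReal.tendsto_toReal hω.ne).comp this).neg)
  have ht2 : Tendsto (fun n => Real.exp (-∫ x, (1 - Real.exp (-(F n x).toReal)) ∂Λ)) atTop
      (nhds (Real.exp (-∫ x, (1 - Real.exp (-(f x).toReal)) ∂Λ))) := by
    refine (Real.continuous_exp.tendsto _).comp (Filter.Tendsto.neg ?_)
    apply tendsto_integral_of_dominated_convergence (fun x => (f x).toReal)
    · intro n
      exact (((F n).measurable.ennreal_toReal.neg.exp).const_sub 1).aestronglyMeasurable
    · exact integrable_toReal_of_lintegral_ne_top hfm.aemeasurable hf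
    · intro n
      filter_upwards [hfae] with x hx
      have h1 : Real.exp (-(F n x).toReal) ≤ 1 := Real.exp_le_one_iff.2 (by simp)
      rw [Real.norm_of_nonneg (by linarith)]
      exact (one_sub_exp_upper _).trans (ENNReal.toReal_mono hx.ne (hFle n x))
    · filter_upwards [hfae] with x hx
      refine Filter.Tendsto.const_sub 1 ((Real.continuous_exp.tendsto _).comp ?_)
      exact ((ENNReal.tendsto_toReal hx.ne).comp (SimpleFunc.tendsto_eapprox hfm x)).neg
  simp_rw [hsim] at ht1
  exact tendsto_nhds_unique ht1 ht2

/-- integral representation of the mean limiting SINR: with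
S = L₀h̃/(Σ_{x_i∈Ψ}L(|x_i|)h_i + 2πγ/(αζ)), Ψ a PPP of intensity β/(2πζ) with i.i.d.
unit-mean nonnegative marks of distribution ν, and h̃ independent, unit-mean, nonnegative,
𝔼[S] = ∫₀^∞ L₀ · exp(−2πγt/(αζ) − (β/ζ)∫₀^∞ 𝔼_h[1 − e^{−thL(r)}] r dr) dt. -/
theorem stmt4 {Ω : Type*} [MeasurableSpace Ω] (P : Measure Ω) [IsProbabilityMeasure P]
    (α β ζ L₀ γ : ℝ) (hα : 0 < α) (hβ : 0 < β) (hζ : 0 < ζ) (hL0 : 0 < L₀) (hγpos : 0 < γ)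
    (ν : Measure ℝ) [IsProbabilityMeasure ν]
    (hν0 : ν (Set.Iio 0) = 0) (hνmean : ∫ x, x ∂ν = 1)
    (L : ℝ → ℝ) (hLmeas : Measurable L) (hLnonneg : ∀ r, 0 ≤ L r)
    (hLmono : AntitoneOn L (Set.Ici 0)) (hL0val : L 0 = L₀)
    (hγ : γ = ∫ r in Set.Ioi (0:ℝ), r * L r)
    (hint : IntegrableOn (fun r => r * L r) (Set.Ioi 0))
    (pp : PoissonPP P ((ENNReal.ofReal (β / (2 * π * ζ)) • (volume : Measure Plane)).prod ν))
    (htilde : Ω → ℝ) (hthmeas : Measurable htilde) (hthn : ∀ ω, 0 ≤ htilde ω)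
    (hthmean : ∫ ω, htilde ω ∂P = 1)
    (hindep : IndepFun htilde (fun ω => (shotNoise pp L ω).toReal) P)
    (S : Ω → ℝ)
    (hS : ∀ ω, S ω = L₀ * htilde ω / ((shotNoise pp L ω).toReal + 2 * π * γ / (α * ζ))) :
    ∫ ω, S ω ∂P =
      ∫ t in Set.Ioi (0:ℝ), L₀ *
        Real.exp (-(2 * π * γ * t / (α * ζ)) -
          (β / ζ) * ∫ r in Set.Ioi (0:ℝ),
            (∫ h, (1 - Real.exp (-(t * h * L r))) ∂ν) * r) := by 
  have hκ : 0 < 2 * π * γ / (α * ζ) := by positivity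
  set κ : ℝ := 2 * π * γ / (α * ζ) with hκdef
  have hcpos : 0 < β / (2 * π * ζ) := by positivity
  set I : Ω → ℝ := fun ω => (shotNoise pp L ω).toReal with hI
  have hI0 : ∀ ω, 0 ≤ I ω := fun ω => ENNReal.toReal_nonneg
  have hbase : Measurable fun p : Plane × ℝ => ENNReal.ofReal (L ‖p.1‖ * p.2) := by fun_prop
  have hImeas : Measurable I :=
    ((Measure.measurable_lintegral hbase).comp pp.measurable_N).ennreal_toReal
  have hνint : Integrable (fun x : ℝ => x) ν := by
    by_contra h
    rw [integral_undef h] at hνmean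
    norm_num at hνmean
  have hνae : ∀ᵐ h ∂ν, 0 ≤ h := by
    rw [ae_iff]
    simpa [Set.Iio] using hν0
  have hLint : Integrable (fun x : Plane => L ‖x‖) (volume : Measure Plane) := by
    rw [integrable_fun_norm_addHaar]
    simpa [Plane] using hint
  let Λ : Measure (Plane × ℝ) :=
    (ENNReal.ofReal (β / (2 * π * ζ)) • (volume : Measure Plane)).prod ν
  have : SigmaFinite (ENNReal.ofReal (β / (2 * π * ζ)) • (volume : Measure Plane)) := by
    have : (ENNReal.ofReal (β / (2 * π * ζ)) • (volume : Measure Plane)).IsAddHaarMeasure :=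
      Measure.IsAddHaarMeasure.smul _ (ENNReal.ofReal_pos.2 hcpos).ne' ENNReal.ofReal_ne_top
    infer_instance
  have hprodint : Integrable (fun p : Plane × ℝ => L ‖p.1‖ * p.2) Λ :=
    (hLint.smul_measure ENNReal.ofReal_ne_top).mul_prod hνint
  have hae2 : ∀ᵐ p ∂Λ, 0 ≤ p.2 := Measure.quasiMeasurePreserving_snd.ae hνae
  have hlap : ∀ t : ℝ, 0 < t → ∫ ω, Real.exp (-(t * I ω)) ∂P =
      Real.exp (-((β / ζ) * ∫ r in Set.Ioi (0:ℝ),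
            (∫ h, (1 - Real.exp (-(t * h * L r))) ∂ν) * r)) := by
    intro t ht
    have hfin : ∫⁻ p, ENNReal.ofReal t * ENNReal.ofReal (L ‖p.1‖ * p.2) ∂Λ ≠ ⊤ := by
      rw [lintegral_const_mul _ hbase]
      exact ENNReal.mul_ne_top ENNReal.ofReal_ne_top hprodint.lintegral_lt_top.ne
    have h := pp.laplace (finePart_plane _ hcpos ν)
      (fun p => ENNReal.ofReal t * ENNReal.ofReal (L ‖p.1‖ * p.2)) (hbase.const_mul _) hfin
    have e1 : ∀ ω, (∫⁻ p, ENNReal.ofReal t * ENNReal.ofReal (L ‖p.1‖ * p.2) ∂(pp.N ω)).toReal =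
        t * I ω := by
      intro ω
      rw [lintegral_const_mul _ hbase, ENNReal.toReal_mul, ENNReal.toReal_ofReal ht.le]
      rfl
    simp_rw [e1] at h
    rw [h]
    congr 2
    have e2 : ∫ p, (1 - Real.exp (-(ENNReal.ofReal t * ENNReal.ofReal (L ‖p.1‖ * p.2)).toReal)) ∂Λ =
        ∫ p, (1 - Real.exp (-(t * p.2 * L ‖p.1‖))) ∂Λ := by
      apply integral_congr_ae
      filter_upwards [hae2] with p hp
      rw [ENNReal.toReal_mul, ENNReal.toReal_ofReal ht.le,
        ENNReal.toReal_ofReal (mul_nonneg (hLnonneg _) hp)]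
      congr 3
      ring
    have hGint : Integrable (fun p : Plane × ℝ => 1 - Real.exp (-(t * p.2 * L ‖p.1‖))) Λ := by
      refine (hprodint.const_mul t).mono' ?_ ?_
      · apply Measurable.aestronglyMeasurable
        fun_prop
      · filter_upwards [hae2] with p hp
        have h0 : 0 ≤ t * p.2 * L ‖p.1‖ := mul_nonneg (mul_nonneg ht.le hp) (hLnonneg _)
        have h1 : Real.exp (-(t * p.2 * L ‖p.1‖)) ≤ 1 := Real.exp_le_one_iff.2 (by linarith)
        rw [Real.norm_of_nonneg (by linarith)]
        refine (one_sub_exp_upper _).trans (le_of_eq ?_)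
        ring
    rw [e2]
    change ∫ p, (1 - Real.exp (-(t * p.2 * L ‖p.1‖))) ∂((ENNReal.ofReal (β / (2 * π * ζ)) • (volume : Measure Plane)).prod ν) = _
    rw [integral_prod _ hGint, integral_smul_measure, ENNReal.toReal_ofReal hcpos.le]
    rw [integral_fun_norm_addHaar (volume : Measure Plane)
      (fun r => ∫ h, (1 - Real.exp (-(t * h * L r))) ∂ν)]
    have e3 : (volume : Measure Plane).real (Metric.ball 0 1) = π := by
      rw [Measure.real, EuclideanSpace.volume_ball_fin_two]
      simp [Real.pi_pos.le]
    have e4 : Module.finrank ℝ Plane = 2 := by simp [Plane]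
    rw [e3, e4]
    simp only [smul_eq_mul, nsmul_eq_mul, Nat.cast_ofNat]
    have e5 : ∫ y in Set.Ioi (0:ℝ), y ^ (2 - 1) * ∫ h, (1 - Real.exp (-(t * h * L y))) ∂ν =
        ∫ r in Set.Ioi (0:ℝ), (∫ h, (1 - Real.exp (-(t * h * L r))) ∂ν) * r := by
      congr 1
      ext y
      simp [mul_comm]
    rw [e5]
    field_simp
  have hES : ∫ ω, S ω ∂P = L₀ * ∫ ω, (I ω + κ)⁻¹ ∂P := by
    have e1 : ∀ ω, S ω = L₀ * (htilde ω * (I ω + κ)⁻¹) := by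
      intro ω
      rw [hS ω, div_eq_mul_inv, mul_assoc]
    simp_rw [e1]
    rw [integral_const_mul]
    have hφ : Measurable fun x : ℝ => (x + κ)⁻¹ := by fun_prop
    have hind : IndepFun htilde (fun ω => (I ω + κ)⁻¹) P := hindep.comp measurable_id hφ
    rw [hind.integral_fun_mul_eq_mul_integral hthmeas.aestronglyMeasurable
      (hφ.comp hImeas).aestronglyMeasurable, hthmean, one_mul]
  have hinv : ∀ ω, (I ω + κ)⁻¹ = ∫ t in Set.Ioi (0:ℝ), Real.exp (-(I ω + κ) * t) := by
    intro ω
    have : 0 < I ω + κ := by linarith [hI0 ω]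
    rw [integral_exp_mul_Ioi (by linarith)]
    simp only [mul_zero, Real.exp_zero, neg_div_neg_eq, one_div]
  have hFub : Integrable (Function.uncurry fun (ω : Ω) (t : ℝ) => Real.exp (-(I ω + κ) * t))
      (P.prod (volume.restrict (Set.Ioi (0:ℝ)))) := by
    have hexp : Integrable (fun t : ℝ => Real.exp (-κ * t)) (volume.restrict (Set.Ioi (0:ℝ))) :=
      integrableOn_exp_mul_Ioi (by linarith) 0
    have hb : Integrable (fun q : Ω × ℝ => (1:ℝ) * Real.exp (-κ * q.2))
        (P.prod (volume.restrict (Set.Ioi (0:ℝ)))) := (integrable_const (1:ℝ)).mul_prod hexp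
    have hpos : ∀ᵐ q ∂(P.prod (volume.restrict (Set.Ioi (0:ℝ)))), q.2 ∈ Set.Ioi (0:ℝ) :=
      Measure.quasiMeasurePreserving_snd.ae (ae_restrict_mem measurableSet_Ioi)
    refine hb.mono' ?_ ?_
    · apply Measurable.aestronglyMeasurable
      unfold Function.uncurry
      fun_prop
    · filter_upwards [hpos] with q hq
      have hq' : 0 < q.2 := hq
      simp only [Function.uncurry]
      rw [one_mul, Real.norm_of_nonneg (Real.exp_pos _).le]
      apply Real.exp_le_exp.2
      nlinarith [mul_nonneg (hI0 q.1) hq'.le]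
  rw [hES]
  simp_rw [hinv]
  rw [integral_integral_swap hFub, ← integral_const_mul]
  apply setIntegral_congr_fun measurableSet_Ioi
  intro t ht
  have ht' : 0 < t := ht
  simp only
  congr 1
  have e6 : ∀ ω, Real.exp (-(I ω + κ) * t) = Real.exp (-(κ * t)) * Real.exp (-(t * I ω)) := by
    intro ω
    rw [← Real.exp_add]
    congr 1
    ring
  simp_rw [e6]
  rw [integral_const_mul, hlap t ht', ← Real.exp_add]
  congr 1
  rw [hκdef]
  ring
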